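/- Second-order expansion of the symmetric community-detection state-evolution function at the uniform fixed point: for every integer r ≥ 2, lim_{y→0⁺} ( M_r(y) − y/r² ) / y² = (r − 4)/(2·r⁴). Equivalently, M_r(y) = y/r² + ((r−4)/(2 r⁴))·y² + o(y²) as y → 0⁺. -/

import Mathlib

open MeasureTheory ProbabilityTheory Filter

/-- The symmetric community-detection state-evolution function
`M_r(x) = (1/(r−1)) · ( r · E[ e^{x/r + U₁√(x/r)} / ( e^{x/r + U₁√(x/r)}
+ Σ_{i=2}^r e^{U_i√(x/r)} ) ] − 1 )`, where `U₁, …, U_r` are i.i.d. standard Gaussians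
(the first coordinate is `p.1`, the remaining `r − 1` coordinates are `p.2`). -/
noncomputable def Mr (r : ℕ) (x : ℝ) : ℝ :=
  (1 / ((r : ℝ) - 1)) *
    ((r : ℝ) *
      (∫ p : ℝ × (Fin (r - 1) → ℝ),
        Real.exp (x / r + p.1 * Real.sqrt (x / r)) /
          (Real.exp (x / r + p.1 * Real.sqrt (x / r)) +
            ∑ i, Real.exp (p.2 i * Real.sqrt (x / r)))
        ∂((gaussianReal 0 1).prod (Measure.pi fun _ : Fin (r - 1) => gaussianReal 0 1)))
      - 1)

/-- `f` is integrable with expectation `c`. -/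
def HasExpectation {Ω : Type*} [MeasurableSpace Ω] (μ : Measure Ω) (f : Ω → ℝ) (c : ℝ) : Prop :=
  Integrable f μ ∧ ∫ u, f u ∂μ = c

namespace HasExpectation

variable {Ω : Type*} [MeasurableSpace Ω] {μ : Measure Ω} {f g : Ω → ℝ} {a b : ℝ}

lemma add (hf : HasExpectation μ f a) (hg : HasExpectation μ g b) :
    HasExpectation μ (fun u => f u + g u) (a + b) :=
  ⟨hf.1.add hg.1, by rw [integral_add hf.1 hg.1, hf.2, hg.2]⟩

lemma const_mul (k : ℝ) (hf : HasExpectation μ f a) :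
    HasExpectation μ (fun u => k * f u) (k * a) :=
  ⟨hf.1.const_mul k, by rw [integral_const_mul, hf.2]⟩

lemma sum {ι : Type*} {s : Finset ι} {F : ι → Ω → ℝ} {c : ι → ℝ}
    (h : ∀ i ∈ s, HasExpectation μ (F i) (c i)) :
    HasExpectation μ (fun u => ∑ i ∈ s, F i u) (∑ i ∈ s, c i) :=
  ⟨integrable_finsetSum _ fun i hi => (h i hi).1, by
    rw [integral_finsetSum _ fun i hi => (h i hi).1]
    exact Finset.sum_congr rfl fun i hi => (h i hi).2⟩

lemma congr (hf : HasExpectation μ f a) (hfg : ∀ u, g u = f u) (hab : b = a) :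
    HasExpectation μ g b := by
  obtain rfl : g = f := funext hfg
  exact hab ▸ hf

end HasExpectation

/-- `f` has finite moments of all orders. -/
def FiniteMoments {Ω : Type*} [MeasurableSpace Ω] (μ : Measure Ω) (f : Ω → ℝ) : Prop :=
  ∀ p : ℕ, MemLp f p μ

namespace FiniteMoments

variable {Ω : Type*} [MeasurableSpace Ω] {μ : Measure Ω} {f g : Ω → ℝ}

lemma integrable (hf : FiniteMoments μ f) : Integrable f μ :=
  memLp_one_iff_integrable.1 (by simpa using hf 1)

lemma mul (hf : FiniteMoments μ f) (hg : FiniteMoments μ g) :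
    FiniteMoments μ (fun u => f u * g u) := fun p => by
  have : ENNReal.HolderTriple ((2 * p : ℕ) : ENNReal) ((2 * p : ℕ) : ENNReal) (p : ENNReal) := by
    constructor
    push_cast
    rw [ENNReal.mul_inv (by simp) (by simp), ← add_mul, ENNReal.inv_two_add_inv_two, one_mul]
  exact (hg (2 * p)).mul' (hf (2 * p))

lemma const [IsFiniteMeasure μ] (c : ℝ) : FiniteMoments μ (fun _ => c) := fun _ => memLp_const c

lemma pow [IsFiniteMeasure μ] (hf : FiniteMoments μ f) (k : ℕ) :
    FiniteMoments μ (fun u => f u ^ k) := by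
  induction k with
  | zero => simpa using const 1
  | succ k ih => simpa only [pow_succ] using ih.mul hf

lemma sum {ι : Type*} {s : Finset ι} {F : ι → Ω → ℝ} (h : ∀ i ∈ s, FiniteMoments μ (F i)) :
    FiniteMoments μ (fun u => ∑ i ∈ s, F i u) := fun p => memLp_finsetSum s fun i hi => h i hi p

end FiniteMoments

/-- Low-order joint moments of the sum and the sum of squares of independent centred variables
sharing their moments `m`. -/
lemma hasExpectation_sum_sumSq {Ω ι : Type*} [MeasurableSpace Ω] {μ : Measure Ω}
    [IsProbabilityMeasure μ] {X : ι → Ω → ℝ} {m : ℕ → ℝ} (hind : iIndepFun X μ)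
    (hX : ∀ i, Measurable (X i)) (hfin : ∀ i, FiniteMoments μ (X i))
    (hm : ∀ i k, ∫ u, X i u ^ k ∂μ = m k) (hm1 : m 1 = 0) (s : Finset ι) :
    HasExpectation μ (fun u => ∑ i ∈ s, X i u) 0 ∧
    HasExpectation μ (fun u => ∑ i ∈ s, X i u ^ 2) (s.card * m 2) ∧
    HasExpectation μ (fun u => (∑ i ∈ s, X i u) ^ 2) (s.card * m 2) ∧
    HasExpectation μ (fun u => (∑ i ∈ s, X i u) * ∑ i ∈ s, X i u ^ 2) (s.card * m 3) ∧
    HasExpectation μ (fun u => (∑ i ∈ s, X i u) ^ 3) (s.card * m 3) ∧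
    HasExpectation μ (fun u => (∑ i ∈ s, X i u) ^ 2 * ∑ i ∈ s, X i u ^ 2)
      (s.card * m 4 + s.card * (s.card - 1) * m 2 ^ 2) ∧
    HasExpectation μ (fun u => (∑ i ∈ s, X i u) ^ 4)
      (s.card * m 4 + 3 * s.card * (s.card - 1) * m 2 ^ 2) := by
  classical
  induction s using Finset.induction_on with
  | empty => simp [HasExpectation]
  | insert i s his ih =>
    set S : Ω → ℝ := fun u => ∑ j ∈ s, X j u with hS
    set Q : Ω → ℝ := fun u => ∑ j ∈ s, X j u ^ 2 with hQ
    have hm0 : m 0 = 1 := by simpa using (hm i 0).symm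
    have key : ∀ a b c {e : ℝ}, HasExpectation μ (fun u => S u ^ a * Q u ^ b) e →
        HasExpectation μ (fun u => S u ^ a * Q u ^ b * X i u ^ c) (e * m c) := by
      intro a b c e he
      have hSf : FiniteMoments μ S := FiniteMoments.sum fun j _ => hfin j
      have hQf : FiniteMoments μ Q := FiniteMoments.sum fun j _ => (hfin j).pow 2
      refine ⟨(((hSf.pow a).mul (hQf.pow b)).mul ((hfin i).pow c)).integrable, ?_⟩
      have hi := (hind.indepFun_finset s {i} (by simpa using his) hX).comp
        (φ := fun z : s → ℝ => (∑ j, z j) ^ a * (∑ j, z j ^ 2) ^ b)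
        (ψ := fun z : ({i} : Finset ι) → ℝ => z ⟨i, by simp⟩ ^ c) (by fun_prop) (by fun_prop)
      have hi' : IndepFun (fun u => S u ^ a * Q u ^ b) (fun u => X i u ^ c) μ := by
        convert hi using 2 with u
        · simp only [hS, hQ, Function.comp]
          rw [← Finset.sum_coe_sort s, ← Finset.sum_coe_sort s]
        · rfl
      rw [hi'.integral_fun_mul_eq_mul_integral
        ((hSf.pow a).mul (hQf.pow b)).integrable.aestronglyMeasurable
        ((hfin i).pow c).integrable.aestronglyMeasurable, he.2, hm]
    obtain ⟨h1, h2, h3, h4, h5, h6, h7⟩ := ih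
    replace h1 : HasExpectation μ (fun u => S u ^ 1 * Q u ^ 0) 0 :=
      h1.congr (by simp [hS]) rfl
    replace h2 : HasExpectation μ (fun u => S u ^ 0 * Q u ^ 1) (s.card * m 2) :=
      h2.congr (by simp [hQ]) rfl
    replace h3 : HasExpectation μ (fun u => S u ^ 2 * Q u ^ 0) (s.card * m 2) :=
      h3.congr (by simp [hS]) rfl
    replace h4 : HasExpectation μ (fun u => S u ^ 1 * Q u ^ 1) (s.card * m 3) :=
      h4.congr (by simp [hS, hQ]) rfl
    replace h5 : HasExpectation μ (fun u => S u ^ 3 * Q u ^ 0) (s.card * m 3) :=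
      h5.congr (by simp [hS]) rfl
    replace h6 : HasExpectation μ (fun u => S u ^ 2 * Q u ^ 1)
        (s.card * m 4 + s.card * (s.card - 1) * m 2 ^ 2) :=
      h6.congr (by simp [hS, hQ]) rfl
    replace h7 : HasExpectation μ (fun u => S u ^ 4 * Q u ^ 0)
        (s.card * m 4 + 3 * s.card * (s.card - 1) * m 2 ^ 2) :=
      h7.congr (by simp [hS]) rfl
    have h0 : HasExpectation μ (fun u => S u ^ 0 * Q u ^ 0) 1 := by simp [HasExpectation]
    simp only [Finset.sum_insert his, Finset.card_insert_of_notMem his, Nat.cast_add, Nat.cast_one]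
    refine ⟨?_, ?_, ?_, ?_, ?_, ?_, ?_⟩
    · refine ((key 1 0 0 h1).add (key 0 0 1 h0)).congr (fun u => ?_) ?_
      · simp only [hS]; ring
      · rw [hm1]; ring
    · refine ((key 0 1 0 h2).add (key 0 0 2 h0)).congr (fun u => ?_) ?_
      · simp only [hQ]; ring
      · rw [hm0]; ring
    · refine (((key 2 0 0 h3).add ((key 1 0 1 h1).const_mul 2)).add (key 0 0 2 h0)).congr
        (fun u => ?_) ?_
      · simp only [hS]; ring
      · rw [hm0]; ring
    · refine ((((key 1 1 0 h4).add (key 1 0 2 h1)).add (key 0 1 1 h2)).add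
        (key 0 0 3 h0)).congr (fun u => ?_) ?_
      · simp only [hS, hQ]; ring
      · rw [hm0, hm1]; ring
    · refine ((((key 3 0 0 h5).add ((key 2 0 1 h3).const_mul 3)).add
        ((key 1 0 2 h1).const_mul 3)).add (key 0 0 3 h0)).congr (fun u => ?_) ?_
      · simp only [hS]; ring
      · rw [hm0, hm1]; ring
    · refine ((((((key 2 1 0 h6).add (key 2 0 2 h3)).add ((key 1 1 1 h4).const_mul 2)).add
        ((key 1 0 3 h1).const_mul 2)).add (key 0 1 2 h2)).add (key 0 0 4 h0)).congr
        (fun u => ?_) ?_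
      · simp only [hS, hQ]; ring
      · rw [hm0, hm1]; ring
    · refine (((((key 4 0 0 h7).add ((key 3 0 1 h5).const_mul 4)).add
        ((key 2 0 2 h3).const_mul 6)).add ((key 1 0 3 h1).const_mul 4)).add
        (key 0 0 4 h0)).congr (fun u => ?_) ?_
      · simp only [hS]; ring
      · rw [hm0, hm1]; ring

/-- Cameron–Martin formula for the standard Gaussian measure on the line. -/
lemma integral_gaussianReal_comp_add (F : ℝ → ℝ) (t : ℝ) :
    ∫ x, F (x + t) ∂gaussianReal 0 1 =
      ∫ x, Real.exp (t * x - t ^ 2 / 2) * F x ∂gaussianReal 0 1 := by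
  rw [integral_gaussianReal_eq_integral_smul one_ne_zero,
    integral_gaussianReal_eq_integral_smul one_ne_zero,
    ← integral_add_right_eq_self
      (fun x => gaussianPDFReal 0 1 x • (Real.exp (t * x - t ^ 2 / 2) * F x)) t]
  refine integral_congr_ae (ae_of_all _ fun x => ?_)
  simp only [gaussianPDFReal, smul_eq_mul]
  rw [← mul_assoc, mul_assoc _ (Real.exp _) (Real.exp _), ← Real.exp_add]
  congr 3
  push_cast
  ring

/-- The exponential martingale `exp (t u - t² / 2)`, centred. -/
noncomputable def centredTilt (t u : ℝ) : ℝ := Real.exp (t * u - t ^ 2 / 2) - 1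

lemma measurable_centredTilt (t : ℝ) : Measurable (centredTilt t) := by
  unfold centredTilt; fun_prop

lemma hasExpectation_exp_pow (t : ℝ) (k : ℕ) :
    HasExpectation (gaussianReal 0 1) (fun u => Real.exp (t * u - t ^ 2 / 2) ^ k)
      (Real.exp (t ^ 2) ^ (k.choose 2)) := by
  have h : ∀ u, Real.exp (t * u - t ^ 2 / 2) ^ k
      = Real.exp (-(k * t ^ 2 / 2)) * Real.exp (k * t * u) := fun u => by
    rw [← Real.exp_nat_mul, ← Real.exp_add]; ring_nf
  refine HasExpectation.congr (HasExpectation.const_mul (a := Real.exp ((k * t) ^ 2 / 2)) _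
    ⟨integrable_exp_mul_gaussianReal (k * t), ?_⟩) h ?_
  · have := congrFun (mgf_fun_id_gaussianReal (μ := 0) (v := 1)) (k * t)
    simpa [mgf] using this
  · rw [← Real.exp_nat_mul, ← Real.exp_add, Nat.cast_choose_two]
    ring_nf

/-- Moments of `centredTilt t` in terms of `q = exp (t²)`. -/
noncomputable def tiltMoment (q : ℝ) (k : ℕ) : ℝ :=
  ∑ j ∈ Finset.range (k + 1), (-1) ^ (j + k) * q ^ (j.choose 2) * k.choose j

lemma hasExpectation_centredTilt_pow (t : ℝ) (k : ℕ) :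
    HasExpectation (gaussianReal 0 1) (fun u => centredTilt t u ^ k)
      (tiltMoment (Real.exp (t ^ 2)) k) := by
  refine (HasExpectation.sum (s := Finset.range (k + 1)) fun j _ =>
    (hasExpectation_exp_pow t j).const_mul ((-1) ^ (j + k) * k.choose j)).congr (fun u => ?_) ?_
  · rw [centredTilt, sub_pow]
    refine Finset.sum_congr rfl fun j _ => ?_
    ring
  · exact Finset.sum_congr rfl fun j _ => by ring

lemma tiltMoment_one (q : ℝ) : tiltMoment q 1 = 0 := by
  simp [tiltMoment, Finset.sum_range_succ]

lemma tiltMoment_two (q : ℝ) : tiltMoment q 2 = q - 1 := by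
  simp [tiltMoment, Finset.sum_range_succ, Nat.choose]; ring

lemma tiltMoment_three (q : ℝ) : tiltMoment q 3 = (q - 1) ^ 2 * (q + 2) := by
  simp [tiltMoment, Finset.sum_range_succ, Nat.choose]; ring

lemma tiltMoment_four (q : ℝ) : tiltMoment q 4 =
    (q - 1) ^ 2 * (q ^ 4 + 2 * q ^ 3 + 3 * q ^ 2 - 3) := by
  simp [tiltMoment, Finset.sum_range_succ, Nat.choose]; ring

lemma tiltMoment_six (q : ℝ) : tiltMoment q 6 = (q - 1) ^ 3 *
    (q ^ 12 + 3 * q ^ 11 + 6 * q ^ 10 + 10 * q ^ 9 +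
      15 * q ^ 8 + 15 * q ^ 7 + 10 * q ^ 6 - 15 * q ^ 4 - 20 * q ^ 3 - 15 * q ^ 2 + 5) := by
  simp [tiltMoment, Finset.sum_range_succ, Nat.choose]; ring

lemma abs_div_one_add_sub_le {B V N t : ℝ} (hB : -1 < B) (hBV : B ^ 2 ≤ V) (hN : 0 ≤ N)
    (hV : V - B ^ 2 ≤ N * (1 + B) ^ 2) (ht : 0 < t) :
    |(1 + 2 * B + V) / (1 + B) - (1 + B + (V - B ^ 2) * (1 - B + B ^ 2))| ≤
      t * V ^ 2 + (1 / t + 4 * N) * V ^ 3 := by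
  have h1 : 0 < 1 + B := by linarith
  have hD : 0 ≤ V - B ^ 2 := by linarith
  have hV0 : 0 ≤ V := (sq_nonneg B).trans hBV
  have hR : (1 + 2 * B + V) / (1 + B) - (1 + B + (V - B ^ 2) * (1 - B + B ^ 2)) =
      -((V - B ^ 2) / (1 + B) * B ^ 3) := by
    field_simp
    ring
  rw [hR, abs_neg, abs_mul, abs_of_nonneg (div_nonneg hD h1.le), abs_pow]
  have hb : |B| ^ 2 = B ^ 2 := sq_abs B
  have hb0 := abs_nonneg B
  have hT : 0 ≤ t * V ^ 2 := by positivity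
  have hT' : 0 ≤ 1 / t * V ^ 3 := by positivity
  have hT'' : 0 ≤ 4 * N * V ^ 3 := by positivity
  rcases le_or_gt (-(1 / 2)) B with h | h
  · have h2 : (V - B ^ 2) / (1 + B) ≤ 2 * V := by
      rw [div_le_iff₀ h1]; nlinarith [sq_nonneg B]
    have h3 : 2 * |B| ^ 3 ≤ t * V + 1 / t * V ^ 2 := by
      have e : t * B ^ 2 + 1 / t * (B ^ 2) ^ 2 - 2 * |B| ^ 3
          = |B| ^ 2 / t * (t - |B|) ^ 2 := by
        rw [← hb]; field_simp; ring
      have e' : 0 ≤ |B| ^ 2 / t * (t - |B|) ^ 2 := by positivity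
      have e1 : t * B ^ 2 ≤ t * V := by gcongr
      have e2 : 1 / t * (B ^ 2) ^ 2 ≤ 1 / t * V ^ 2 := by gcongr
      linarith
    calc (V - B ^ 2) / (1 + B) * |B| ^ 3 ≤ 2 * V * |B| ^ 3 := by gcongr
      _ = V * (2 * |B| ^ 3) := by ring
      _ ≤ V * (t * V + 1 / t * V ^ 2) := by gcongr
      _ ≤ _ := by linarith
  · have h2 : (V - B ^ 2) / (1 + B) ≤ N / 2 := by
      rw [div_le_iff₀ h1]; nlinarith [mul_nonneg hN h1.le]
    have h3 : 1 / 2 ≤ |B| := by rw [abs_of_neg (by linarith)]; linarith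
    have h4 : (1 / 2 : ℝ) ^ 3 ≤ |B| ^ 3 := by gcongr
    have h5 : |B| ^ 6 ≤ V ^ 3 := by
      calc |B| ^ 6 = (B ^ 2) ^ 3 := by rw [← hb]; ring
        _ ≤ V ^ 3 := by gcongr
    calc (V - B ^ 2) / (1 + B) * |B| ^ 3 ≤ N / 2 * |B| ^ 3 := by gcongr
      _ ≤ N / 2 * (8 * (|B| ^ 3 * |B| ^ 3)) := by
          have : 0 ≤ |B| ^ 3 := by positivity
          gcongr
          nlinarith
      _ = 4 * N * |B| ^ 6 := by ring
      _ ≤ 4 * N * V ^ 3 := by gcongr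
      _ ≤ _ := by linarith

lemma abs_sum_sq_div_sum_sub_le {ι : Type*} [Fintype ι] [Nonempty ι] {b : ι → ℝ}
    (hb : ∀ i, -1 < b i) {N t : ℝ} (hN : N = Fintype.card ι) (ht : 0 < t) :
    |(∑ i, (1 + b i) ^ 2) / ∑ i, (1 + b i) -
      (1 + (∑ i, b i) / N + ((∑ i, b i ^ 2) / N - ((∑ i, b i) / N) ^ 2) *
        (1 - (∑ i, b i) / N + ((∑ i, b i) / N) ^ 2))| ≤
      t * ((∑ i, b i ^ 4) / N) + (1 / t + 4 * N) * ((∑ i, b i ^ 6) / N) := by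
  have hN0 : 0 < N := by rw [hN]; exact_mod_cast Fintype.card_pos
  have mean : ∀ (z : ι → ℝ), (∀ i, 0 ≤ z i) → ∀ k, ((∑ i, z i) / N) ^ k ≤ (∑ i, z i ^ k) / N := by
    intro z hz k
    have := Real.pow_arith_mean_le_arith_mean_pow Finset.univ (fun _ => 1 / N) z
      (fun _ _ => by positivity) (by simp [← hN, hN0.ne']) (fun i _ => hz i) k
    simpa [← Finset.mul_sum, div_eq_inv_mul] using this
  have hsum : ∑ i, (1 + b i) = N * (1 + (∑ i, b i) / N) := by
    rw [Finset.sum_add_distrib]; simp [← hN]; field_simp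
  have hsum2 : ∑ i, (1 + b i) ^ 2 = N * (1 + 2 * ((∑ i, b i) / N) + (∑ i, b i ^ 2) / N) := by
    simp only [add_sq, Finset.sum_add_distrib, mul_one, one_pow, ← Finset.mul_sum]
    simp [← hN]; field_simp
  have hpos : 0 < ∑ i, (1 + b i) := Finset.sum_pos (fun i _ => by linarith [hb i])
    Finset.univ_nonempty
  have hB : -1 < (∑ i, b i) / N := by
    rw [hsum] at hpos
    linarith [pos_of_mul_pos_right hpos hN0.le]
  have hle : ∑ i, (1 + b i) ^ 2 ≤ (∑ i, (1 + b i)) ^ 2 :=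
    Finset.sum_sq_le_sq_sum_of_nonneg fun i _ => by linarith [hb i]
  have hBV : ((∑ i, b i) / N) ^ 2 ≤ (∑ i, b i ^ 2) / N := by
    have := sq_sum_le_card_mul_sum_sq (s := Finset.univ) (f := b)
    rw [Finset.card_univ, ← hN] at this
    rw [div_pow, div_le_div_iff₀ (by positivity) hN0]
    nlinarith
  rw [hsum, hsum2] at hle
  rw [hsum, hsum2, mul_div_mul_left _ _ hN0.ne']
  set B := (∑ i, b i) / N
  set V := (∑ i, b i ^ 2) / N with hVdef
  have hV : V - B ^ 2 ≤ N * (1 + B) ^ 2 := by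
    have h' : 1 + 2 * B + V ≤ N * (1 + B) ^ 2 := by
      refine le_of_mul_le_mul_left ?_ hN0
      nlinarith
    nlinarith [sq_nonneg (1 + B)]
  refine (abs_div_one_add_sub_le hB hBV hN0.le hV ht).trans ?_
  have h2 := mean (fun i => b i ^ 2) (fun i => sq_nonneg _) 2
  have h3 := mean (fun i => b i ^ 2) (fun i => sq_nonneg _) 3
  simp only [← pow_mul] at h2 h3
  gcongr

/-- The polynomial part of the expansion of `r 𝔼[softmax] - 1`. -/
noncomputable def mainTerm (N q : ℝ) : ℝ :=
  tiltMoment q 2 * (1 - 1 / N) - tiltMoment q 3 * (1 / N - 1 / N ^ 2) +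
    (tiltMoment q 4 + (N - 1) * tiltMoment q 2 ^ 2) / N ^ 2 -
    (tiltMoment q 4 + 3 * (N - 1) * tiltMoment q 2 ^ 2) / N ^ 3

lemma neg_one_lt_centredTilt (t u : ℝ) : -1 < centredTilt t u := by
  unfold centredTilt
  linarith [Real.exp_pos (t * u - t ^ 2 / 2)]

lemma finiteMoments_centredTilt (t : ℝ) : FiniteMoments (gaussianReal 0 1) (centredTilt t) := by
  intro p
  refine MemLp.mono_exponent (q := ((2 * p : ℕ) : ENNReal)) ?_ (by exact_mod_cast by omega)
  rcases p.eq_zero_or_pos with rfl | hp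
  · simpa using (measurable_centredTilt t).aestronglyMeasurable
  rw [← integrable_norm_rpow_iff (measurable_centredTilt t).aestronglyMeasurable
    (by simp; omega) (ENNReal.natCast_ne_top _)]
  have := (hasExpectation_centredTilt_pow t (2 * p)).1
  refine this.congr (ae_of_all _ fun u => ?_)
  simp only [ENNReal.toReal_natCast, Real.rpow_natCast, Real.norm_eq_abs]
  rw [Even.pow_abs (even_two_mul p)]

lemma abs_integral_sum_sq_div_sum_sub_le {ι : Type*} [Fintype ι] [Nonempty ι] {N t : ℝ}
    (hN : N = Fintype.card ι) (ht : 0 < t) :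
    |∫ u : ι → ℝ, (∑ i, (1 + centredTilt t (u i)) ^ 2) / ∑ i, (1 + centredTilt t (u i))
        ∂(Measure.pi fun _ => gaussianReal 0 1) - (1 + mainTerm N (Real.exp (t ^ 2)))| ≤
      t * tiltMoment (Real.exp (t ^ 2)) 4 + (1 / t + 4 * N) * tiltMoment (Real.exp (t ^ 2)) 6 := by
  have hN0 : 0 < N := by rw [hN]; exact_mod_cast Fintype.card_pos
  set μ : Measure (ι → ℝ) := Measure.pi fun _ => gaussianReal 0 1 with hμ
  set m := tiltMoment (Real.exp (t ^ 2)) with hm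
  have hmeas := measurable_centredTilt t
  have hpow : ∀ i k, HasExpectation μ (fun u => centredTilt t (u i) ^ k) (m k) := fun i k => by
    have h := hasExpectation_centredTilt_pow t k
    exact ⟨((measurePreserving_eval (fun _ : ι => gaussianReal 0 1) i).integrable_comp_of_integrable
      h.1 :),
      (integral_comp_eval (μ := fun _ : ι => gaussianReal 0 1) (i := i)
        h.1.aestronglyMeasurable).trans h.2⟩
  obtain ⟨h1, h2, h3, h4, h5, h6, h7⟩ := hasExpectation_sum_sumSq (μ := μ) (m := m)
    (X := fun i u => centredTilt t (u i))
    (iIndepFun_pi fun _ => hmeas.aemeasurable) (fun i => by fun_prop)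
    (fun i p => (finiteMoments_centredTilt t p).comp_measurePreserving (measurePreserving_eval _ i))
    (fun i k => (hpow i k).2) (tiltMoment_one _) Finset.univ
  simp only [Finset.card_univ, ← hN] at h1 h2 h3 h4 h5 h6 h7
  have hone : HasExpectation μ (fun _ => (1 : ℝ)) 1 := by simp [HasExpectation]
  set f : (ι → ℝ) → ℝ := fun u =>
    (∑ i, (1 + centredTilt t (u i)) ^ 2) / ∑ i, (1 + centredTilt t (u i)) with hf
  set g : (ι → ℝ) → ℝ := fun u =>
    1 + (∑ i, centredTilt t (u i)) / N +
      ((∑ i, centredTilt t (u i) ^ 2) / N - ((∑ i, centredTilt t (u i)) / N) ^ 2) *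
        (1 - (∑ i, centredTilt t (u i)) / N + ((∑ i, centredTilt t (u i)) / N) ^ 2) with hg
  have hgE : HasExpectation μ g (1 + mainTerm N (Real.exp (t ^ 2))) := by
    refine (((((((hone.add (h1.const_mul (1 / N))).add (h2.const_mul (1 / N))).add
      (h3.const_mul (-1 / N ^ 2))).add (h4.const_mul (-1 / N ^ 2))).add
      (h5.const_mul (1 / N ^ 3))).add (h6.const_mul (1 / N ^ 3))).add
      (h7.const_mul (-1 / N ^ 4))).congr (fun u => ?_) ?_
    · simp only [hg]; field_simp; ring
    · simp only [mainTerm, ← hm]; field_simp; ring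
  have hsum : ∀ k, HasExpectation μ (fun u => (∑ i, centredTilt t (u i) ^ k) / N) (m k) := fun k =>
    ((HasExpectation.sum (s := Finset.univ) fun i _ => hpow i k).const_mul (1 / N)).congr
      (fun u => by ring) (by simp [← hN]; field_simp)
  have herr := ((hsum 4).const_mul t).add ((hsum 6).const_mul (1 / t + 4 * N))
  have hle : ∀ u, |f u - g u| ≤ _ := fun u =>
    abs_sum_sq_div_sum_sub_le (fun i => neg_one_lt_centredTilt t (u i)) hN ht
  have hsub : Integrable (fun u => f u - g u) μ :=
    Integrable.mono' (f := fun u => f u - g u) herr.1 (by simp only [hf, hg]; fun_prop)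
      (ae_of_all _ hle)
  have hfint : Integrable f μ := (hsub.add hgE.1).congr (ae_of_all _ fun u => by simp)
  rw [← hgE.2, ← integral_sub hfint hgE.1, ← herr.2]
  exact norm_integral_le_of_norm_le (f := fun u => f u - g u) herr.1 (ae_of_all _ hle)

lemma integral_prod_comp_add {E : Type*} [MeasurableSpace E] (ν : Measure E)
    [IsProbabilityMeasure ν] {F : ℝ × E → ℝ} (hF : Measurable F) (hbdd : ∀ p, |F p| ≤ 1) (t : ℝ) :
    ∫ p, F (p.1 + t, p.2) ∂((gaussianReal 0 1).prod ν) =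
      ∫ p, Real.exp (t * p.1 - t ^ 2 / 2) * F p ∂((gaussianReal 0 1).prod ν) := by
  rw [integral_prod_symm, integral_prod_symm]
  · exact integral_congr_ae (ae_of_all _ fun y =>
      integral_gaussianReal_comp_add (fun x => F (x, y)) t)
  · have h : Integrable (fun p : ℝ × E => Real.exp (t * p.1 - t ^ 2 / 2))
        ((gaussianReal 0 1).prod ν) :=
      Integrable.comp_fst (f := fun x => Real.exp (t * x - t ^ 2 / 2))
        (by simpa using (hasExpectation_exp_pow t 1).1) ν
    exact h.mul_bdd (c := 1) hF.aestronglyMeasurable (ae_of_all _ hbdd)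
  · exact Integrable.of_bound (Measurable.aestronglyMeasurable (by fun_prop)) 1
      (ae_of_all _ fun p => hbdd _)

lemma abs_div_add_le_one {a b : ℝ} (ha : 0 < a) (hb : 0 ≤ b) : |a / (a + b)| ≤ 1 := by
  rw [abs_of_nonneg (by positivity), div_le_one (by positivity)]
  linarith

/-- After a change of measure, the softmax expectation is a size-biased share. -/
lemma integral_softmax_eq (n : ℕ) (t : ℝ) :
    ∫ p : ℝ × (Fin n → ℝ), Real.exp (t ^ 2 + p.1 * t) /
        (Real.exp (t ^ 2 + p.1 * t) + ∑ i, Real.exp (p.2 i * t))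
      ∂((gaussianReal 0 1).prod (Measure.pi fun _ : Fin n => gaussianReal 0 1)) =
    ∫ p : ℝ × (Fin n → ℝ), (1 + centredTilt t p.1) ^ 2 /
        ((1 + centredTilt t p.1) + ∑ i, (1 + centredTilt t (p.2 i)))
      ∂((gaussianReal 0 1).prod (Measure.pi fun _ : Fin n => gaussianReal 0 1)) := by
  have h := integral_prod_comp_add (Measure.pi fun _ : Fin n => gaussianReal 0 1)
    (F := fun p => Real.exp (t * p.1) / (Real.exp (t * p.1) + ∑ i, Real.exp (t * p.2 i)))
    (by fun_prop) (fun p => abs_div_add_le_one (Real.exp_pos _)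
      (Finset.sum_nonneg fun i _ => (Real.exp_pos _).le)) t
  refine Eq.trans (integral_congr_ae (ae_of_all _ fun p => ?_)) (h.trans
    (integral_congr_ae (ae_of_all _ fun p => ?_)))
  · simp only [mul_comm _ t, mul_add, sq, add_comm]
  · have hc : ∀ u, 1 + centredTilt t u = Real.exp (-(t ^ 2 / 2)) * Real.exp (t * u) := fun u => by
      rw [centredTilt, ← Real.exp_add]; ring_nf
    have hS : 0 < Real.exp (t * p.1) + ∑ i, Real.exp (t * p.2 i) :=
      add_pos_of_pos_of_nonneg (Real.exp_pos _) (Finset.sum_nonneg fun i _ => (Real.exp_pos _).le)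
    simp only [hc, ← Finset.mul_sum, ← mul_add]
    rw [sub_eq_neg_add, Real.exp_add]
    field_simp

/-- Exchangeability: the size-biased share averages to a symmetric ratio. -/
lemma card_mul_integral_share (n : ℕ) {a : ℝ → ℝ} (ha : Measurable a) (hpos : ∀ x, 0 < a x)
    {μ : Measure ℝ} [IsProbabilityMeasure μ] (hint : Integrable a μ) :
    ((n : ℝ) + 1) * ∫ p : ℝ × (Fin n → ℝ), a p.1 ^ 2 / (a p.1 + ∑ i, a (p.2 i))
        ∂(μ.prod (Measure.pi fun _ : Fin n => μ)) =
      ∫ u : Fin (n + 1) → ℝ, (∑ i, a (u i) ^ 2) / ∑ i, a (u i)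
        ∂(Measure.pi fun _ => μ) := by
  set J := ∫ p : ℝ × (Fin n → ℝ), a p.1 ^ 2 / (a p.1 + ∑ i, a (p.2 i))
    ∂(μ.prod (Measure.pi fun _ : Fin n => μ)) with hJ
  have hterm : ∀ i : Fin (n + 1), ∫ u : Fin (n + 1) → ℝ, a (u i) ^ 2 / ∑ j, a (u j)
      ∂(Measure.pi fun _ => μ) = J := by
    intro i
    rw [hJ, ← (measurePreserving_piFinSuccAbove (fun _ : Fin (n + 1) => μ) i).integral_comp'
      (fun p => a p.1 ^ 2 / (a p.1 + ∑ i, a (p.2 i)))]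
    refine integral_congr_ae (ae_of_all _ fun u => ?_)
    simp only [Fin.sum_univ_succAbove _ i]
    rfl
  simp only [Finset.sum_div]
  rw [integral_finsetSum, Finset.sum_congr rfl fun i _ => hterm i]
  · simp
  · intro i _
    have hi : Integrable (fun u : Fin (n + 1) → ℝ => a (u i)) (Measure.pi fun _ => μ) :=
      ((measurePreserving_eval (fun _ : Fin (n + 1) => μ) i).integrable_comp_of_integrable hint :)
    refine hi.mono' (Measurable.aestronglyMeasurable (by fun_prop)) (ae_of_all _ fun u => ?_)
    have hle : a (u i) ≤ ∑ j, a (u j) :=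
      Finset.single_le_sum (f := fun j => a (u j)) (fun j _ => (hpos _).le) (Finset.mem_univ i)
    have hs : 0 < ∑ j, a (u j) := (hpos _).trans_le hle
    rw [Real.norm_of_nonneg (by positivity), div_le_iff₀ hs, sq]
    exact mul_le_mul_of_nonneg_left hle (hpos _).le

lemma abs_Mr_sub_le (r : ℕ) (hr : 2 ≤ r) {y : ℝ} (hy : 0 < y) :
    |Mr r y - 1 / ((r : ℝ) - 1) * mainTerm r (Real.exp (y / r))| ≤
      1 / ((r : ℝ) - 1) * (√(y / r) * tiltMoment (Real.exp (y / r)) 4 +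
        (1 / √(y / r) + 4 * r) * tiltMoment (Real.exp (y / r)) 6) := by
  obtain ⟨n, rfl⟩ : ∃ n, r = n + 1 := ⟨r - 1, by omega⟩
  have hs : 0 < y / ((n + 1 : ℕ) : ℝ) := by positivity
  set t := √(y / ((n + 1 : ℕ) : ℝ)) with ht
  have htpos : 0 < t := Real.sqrt_pos.2 hs
  have hts : y / ((n + 1 : ℕ) : ℝ) = t ^ 2 := (Real.sq_sqrt hs.le).symm
  have hMr : Mr (n + 1) y = 1 / (((n + 1 : ℕ) : ℝ) - 1) *
      (∫ u : Fin (n + 1) → ℝ, (∑ i, (1 + centredTilt t (u i)) ^ 2) / ∑ i, (1 + centredTilt t (u i))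
        ∂(Measure.pi fun _ => gaussianReal 0 1) - 1) := by
    rw [← card_mul_integral_share n (a := fun x => 1 + centredTilt t x)
      ((measurable_centredTilt t).const_add 1)
      (fun x => by linarith [neg_one_lt_centredTilt t x])
      ((integrable_const 1).add (finiteMoments_centredTilt t).integrable),
      ← integral_softmax_eq, Mr, ← ht, hts, Nat.cast_add, Nat.cast_one]
    rfl
  have h := abs_integral_sum_sq_div_sum_sub_le (ι := Fin (n + 1)) (N := ((n + 1 : ℕ) : ℝ)) (by simp)
    htpos
  have hn : 0 ≤ 1 / (((n + 1 : ℕ) : ℝ) - 1) := by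
    push_cast; rw [add_sub_cancel_right]; positivity
  rw [hMr, hts, ← mul_sub, abs_mul, abs_of_nonneg hn]
  refine mul_le_mul_of_nonneg_left ?_ hn
  rwa [sub_sub]

lemma tendsto_exp_sub_one_div :
    Tendsto (fun s => (Real.exp s - 1) / s) (nhdsWithin 0 (Set.Ioi 0)) (nhds 1) := by
  have h := (Real.hasDerivAt_exp 0).tendsto_slope_zero_right
  simpa [div_eq_inv_mul] using h

lemma tendsto_exp_sub_one_sub_div_sq :
    Tendsto (fun s => (Real.exp s - 1 - s) / s ^ 2) (nhdsWithin 0 (Set.Ioi 0)) (nhds (1 / 2)) := by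
  have hb : ∀ᶠ s : ℝ in nhdsWithin 0 (Set.Ioi 0),
      ‖(Real.exp s - 1 - s) / s ^ 2 - 1 / 2‖ ≤ s := by
    filter_upwards [Ioo_mem_nhdsGT (zero_lt_one' ℝ)] with s hs
    have h := Real.exp_bound (x := s) (by rw [abs_of_pos hs.1]; exact hs.2.le) (n := 3)
      (by norm_num)
    have hs0 := hs.1
    simp [Finset.sum_range_succ, Nat.factorial] at h
    rw [abs_of_pos hs0] at h
    have e : (Real.exp s - 1 - s) / s ^ 2 - 1 / 2 = (Real.exp s - (1 + s + s ^ 2 / 2)) / s ^ 2 := by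
      field_simp; ring
    rw [e, norm_div, Real.norm_eq_abs, Real.norm_of_nonneg (by positivity),
      div_le_iff₀ (by positivity)]
    refine h.trans ?_
    have : 0 ≤ s ^ 3 := by positivity
    nlinarith
  rw [tendsto_iff_norm_sub_tendsto_zero]
  exact squeeze_zero' (Eventually.of_forall fun _ => norm_nonneg _) hb
    (tendsto_nhdsWithin_of_tendsto_nhds tendsto_id)

lemma tendsto_exp_nhdsGT_zero :
    Tendsto Real.exp (nhdsWithin 0 (Set.Ioi 0)) (nhds 1) :=
  tendsto_nhdsWithin_of_tendsto_nhds (by simpa using Real.continuous_exp.tendsto 0)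

lemma tendsto_comp_exp {k : ℝ → ℝ} (hk : Continuous k) :
    Tendsto (fun s => k (Real.exp s)) (nhdsWithin 0 (Set.Ioi 0)) (nhds (k 1)) :=
  (hk.tendsto 1).comp tendsto_exp_nhdsGT_zero

lemma tendsto_mainTerm {N : ℝ} (hN : N ≠ 0) :
    Tendsto (fun s => (mainTerm N (Real.exp s) - s * (N - 1) / N) / s ^ 2)
      (nhdsWithin 0 (Set.Ioi 0)) (nhds ((N - 1) * (N - 4) / (2 * N ^ 2))) := by
  have h3 := tendsto_comp_exp (k := fun q => q + 2) (by fun_prop)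
  have h4 := tendsto_comp_exp (k := fun q => q ^ 4 + 2 * q ^ 3 + 3 * q ^ 2 - 3) (by fun_prop)
  have hd := tendsto_exp_sub_one_div
  have hlim := (((tendsto_exp_sub_one_sub_div_sq.mul_const (1 - 1 / N)).sub
    (((hd.pow 2).mul h3).mul_const (1 / N - 1 / N ^ 2))).add
    (((hd.pow 2).mul (h4.add_const (N - 1))).div_const (N ^ 2))).sub
    (((hd.pow 2).mul (h4.add_const (3 * (N - 1)))).div_const (N ^ 3))
  refine (hlim.congr' ?_).trans (le_of_eq ?_)
  · filter_upwards [self_mem_nhdsWithin] with s hs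
    have hs0 : s ≠ 0 := (Set.mem_Ioi.1 hs).ne'
    simp only [mainTerm, tiltMoment_two, tiltMoment_three, tiltMoment_four]
    field_simp
    ring
  · congr 1
    field_simp
    ring

lemma tendsto_error (N : ℝ) :
    Tendsto (fun s => (√s * tiltMoment (Real.exp s) 4 +
        (1 / √s + 4 * N) * tiltMoment (Real.exp s) 6) / s ^ 2)
      (nhdsWithin 0 (Set.Ioi 0)) (nhds 0) := by
  have h4 := tendsto_comp_exp (k := fun q => q ^ 4 + 2 * q ^ 3 + 3 * q ^ 2 - 3) (by fun_prop)
  have h6 := tendsto_comp_exp (k := fun q => q ^ 12 + 3 * q ^ 11 + 6 * q ^ 10 + 10 * q ^ 9 +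
    15 * q ^ 8 + 15 * q ^ 7 + 10 * q ^ 6 - 15 * q ^ 4 - 20 * q ^ 3 - 15 * q ^ 2 + 5) (by fun_prop)
  have hd := tendsto_exp_sub_one_div
  have hsqrt : Tendsto (fun s => √s) (nhdsWithin 0 (Set.Ioi 0)) (nhds 0) :=
    tendsto_nhdsWithin_of_tendsto_nhds (by simpa using Real.continuous_sqrt.tendsto 0)
  have hlim := (hsqrt.mul ((hd.pow 2).mul h4)).add
    ((hsqrt.add ((hsqrt.pow 2).const_mul (4 * N))).mul ((hd.pow 3).mul h6))
  refine (hlim.congr' ?_).trans (le_of_eq (by simp))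
  filter_upwards [self_mem_nhdsWithin] with s hs
  have hs0 : 0 < s := hs
  obtain ⟨t, ht, rfl⟩ : ∃ t : ℝ, 0 < t ∧ s = t ^ 2 :=
    ⟨√s, Real.sqrt_pos.2 hs0, (Real.sq_sqrt hs0.le).symm⟩
  simp only [tiltMoment_four, tiltMoment_six, Real.sqrt_sq ht.le]
  field_simp

/-- **Second-order expansion of the symmetric community-detection state-evolution
function at the uniform fixed point**: for every integer `r ≥ 2`,
`M_r(y) = y/r² + ((r−4)/(2r⁴))·y² + o(y²)` as `y → 0⁺`. -/
theorem community_detection_second_order_expansion (r : ℕ) (hr : 2 ≤ r) :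
    Tendsto (fun y => (Mr r y - y / (r : ℝ) ^ 2) / y ^ 2)
      (nhdsWithin 0 (Set.Ioi 0))
      (nhds (((r : ℝ) - 4) / (2 * (r : ℝ) ^ 4))) := by
  have hr0 : (0 : ℝ) < r := by positivity
  have hr1 : (0 : ℝ) < (r : ℝ) - 1 := by
    have : (2 : ℝ) ≤ r := by exact_mod_cast hr
    linarith
  have hscale : Tendsto (fun y : ℝ => y / r) (nhdsWithin 0 (Set.Ioi 0))
      (nhdsWithin 0 (Set.Ioi 0)) := by
    refine tendsto_nhdsWithin_iff.2 ⟨tendsto_nhdsWithin_of_tendsto_nhds ?_, ?_⟩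
    · exact (continuous_id.div_const (r : ℝ)).tendsto' 0 0 (by simp)
    · filter_upwards [self_mem_nhdsWithin] with y hy using div_pos hy hr0
  have hmain := ((tendsto_mainTerm hr0.ne').comp hscale).const_mul
    (1 / ((r : ℝ) - 1) * (1 / (r : ℝ) ^ 2))
  have herr := ((tendsto_error r).comp hscale).const_mul (1 / ((r : ℝ) - 1) * (1 / (r : ℝ) ^ 2))
  rw [mul_zero] at herr
  have hdiff : Tendsto (fun y => (Mr r y - 1 / ((r : ℝ) - 1) *
      mainTerm r (Real.exp (y / r))) / y ^ 2) (nhdsWithin 0 (Set.Ioi 0)) (nhds 0) := by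
    refine squeeze_zero_norm' ?_ herr
    filter_upwards [self_mem_nhdsWithin] with y hy
    have hy0 : 0 < y := hy
    rw [norm_div, Real.norm_eq_abs, Real.norm_of_nonneg (by positivity),
      div_le_iff₀ (by positivity)]
    refine (abs_Mr_sub_le r hr hy).trans (le_of_eq ?_)
    simp only [Function.comp]
    field_simp
  refine ((hdiff.add hmain).congr' ?_).trans (le_of_eq ?_)
  · filter_upwards [self_mem_nhdsWithin] with y hy
    have hy0 : y ≠ 0 := (Set.mem_Ioi.1 hy).ne'
    simp only [Function.comp]
    field_simp
    ring
  · congr 1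
    field_simp
    ring
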